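/- arXiv:2303.14629 — 2 statements merged into one kernel-verified Lean document; each statement's English description precedes it below -/
import Mathlib

section
/- Let d₁ ≤ d₂ be positive integers and c₁, c₂ > 0. Let m, n : ℕ → ℕ be sequences of positive integers with m(N) = c₁ N^{d₁} + O(N^{d₁−1}) and n(N) = c₂ N^{d₂} + O(N^{d₂−1}) as N → ∞. Then as N → ∞, the quantity H_{m(N)n(N)} − H_{n(N)} − (m(N)−1)/(2n(N)) equals d₁ ln N + ln c₁ − c₁/(2c₂) + O(1/N) when d₁ = d₂, and equals d₁ ln N + ln c₁ + O(1/N) when d₁ < d₂. -/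
open Asymptotics Filter

noncomputable section

/-- The `N`-th harmonic number `H_N = ∑_{k=1}^N 1/k`, as a real number. -/
def harmonicR (N : ℕ) : ℝ := ∑ k ∈ Finset.Icc 1 N, (1 : ℝ) / k

open Topology

theorem harmonicR_eq_harmonic (k : ℕ) : harmonicR k = (harmonic k : ℝ) := by
  simp [harmonicR, harmonic_eq_sum_Icc]

theorem abs_harmonicR_sub_log_sub_eulerMascheroni_le {k : ℕ} (hk : 0 < k) :
    |harmonicR k - Real.log k - Real.eulerMascheroniConstant| ≤ 1 / (k : ℝ) := by
  have hk' : (0 : ℝ) < k := by exact_mod_cast hk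
  have h₁ := Real.eulerMascheroniSeq_lt_eulerMascheroniConstant k
  have h₂ := Real.eulerMascheroniConstant_lt_eulerMascheroniSeq' k
  rw [Real.eulerMascheroniSeq] at h₁
  rw [Real.eulerMascheroniSeq', if_neg hk.ne'] at h₂
  have h₃ : Real.log ((k : ℝ) + 1) - Real.log k ≤ 1 / (k : ℝ) := by
    rw [← Real.log_div (by positivity) hk'.ne']
    refine (Real.log_le_sub_one_of_pos (by positivity)).trans_eq ?_
    field_simp
    ring
  rw [harmonicR_eq_harmonic, abs_of_pos (by linarith)]
  linarith

theorem abs_harmonicR_mul_sub_harmonicR_sub_log_le {m n : ℕ} (hm : 0 < m) (hn : 0 < n) :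
    |harmonicR (m * n) - harmonicR n - Real.log m| ≤ 2 * (1 / (n : ℝ)) := by
  have hm' : (1 : ℝ) ≤ m := by exact_mod_cast hm
  have hn' : (0 : ℝ) < n := by exact_mod_cast hn
  have h₁ := abs_harmonicR_sub_log_sub_eulerMascheroni_le (Nat.mul_pos hm hn)
  have h₂ := abs_harmonicR_sub_log_sub_eulerMascheroni_le hn
  have h₃ : 1 / ((m * n : ℕ) : ℝ) ≤ 1 / (n : ℝ) := by
    push_cast
    exact one_div_le_one_div_of_le hn' (le_mul_of_one_le_left hn'.le hm')
  have h₄ : Real.log ((m * n : ℕ) : ℝ) = Real.log m + Real.log n := by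
    push_cast
    exact Real.log_mul (by positivity) hn'.ne'
  rw [h₄] at h₁
  rw [abs_le] at *
  constructor <;> linarith [h₁.1, h₁.2, h₂.1, h₂.2]

section LeadingTerm

variable {d : ℕ} {c : ℝ} {u : ℕ → ℝ}

theorem isBigO_div_pow_sub (hd : 1 ≤ d)
    (hu : (fun N : ℕ => u N - c * (N : ℝ) ^ d) =O[atTop] fun N : ℕ => (N : ℝ) ^ (d - 1)) :
    (fun N : ℕ => u N / (N : ℝ) ^ d - c) =O[atTop] fun N : ℕ => 1 / (N : ℝ) := by
  refine (hu.mul (isBigO_refl (fun N : ℕ => ((N : ℝ) ^ d)⁻¹) atTop)).congr' ?_ ?_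
  · filter_upwards [eventually_gt_atTop 0] with N hN
    have : (N : ℝ) ≠ 0 := by exact_mod_cast hN.ne'
    field_simp
  · filter_upwards [eventually_gt_atTop 0] with N hN
    have : (N : ℝ) ≠ 0 := by exact_mod_cast hN.ne'
    obtain ⟨e, rfl⟩ := Nat.exists_eq_add_of_le' hd
    simp only [Nat.add_sub_cancel, pow_succ]
    field_simp

theorem tendsto_div_pow (hd : 1 ≤ d)
    (hu : (fun N : ℕ => u N - c * (N : ℝ) ^ d) =O[atTop] fun N : ℕ => (N : ℝ) ^ (d - 1)) :
    Tendsto (fun N : ℕ => u N / (N : ℝ) ^ d) atTop (𝓝 c) :=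
  tendsto_sub_nhds_zero_iff.mp
    ((isBigO_div_pow_sub hd hu).trans_tendsto tendsto_one_div_atTop_nhds_zero_nat)

theorem isBigO_inv_of_leading_term (hd : 1 ≤ d) (hc : c ≠ 0)
    (hu : (fun N : ℕ => u N - c * (N : ℝ) ^ d) =O[atTop] fun N : ℕ => (N : ℝ) ^ (d - 1)) :
    (fun N : ℕ => (u N)⁻¹) =O[atTop] fun N : ℕ => ((N : ℝ) ^ d)⁻¹ := by
  have h := ((tendsto_div_pow hd hu).inv₀ hc).isBigO_one ℝ
  refine (h.mul (isBigO_refl (fun N : ℕ => ((N : ℝ) ^ d)⁻¹) atTop)).congr' ?_ ?_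
  · filter_upwards [eventually_gt_atTop 0] with N hN
    have : (N : ℝ) ≠ 0 := by exact_mod_cast hN.ne'
    field_simp
  · simp

theorem isBigO_log_sub (hd : 1 ≤ d) (hc : c ≠ 0)
    (hu : (fun N : ℕ => u N - c * (N : ℝ) ^ d) =O[atTop] fun N : ℕ => (N : ℝ) ^ (d - 1)) :
    (fun N : ℕ => Real.log (u N) - (d * Real.log N + Real.log c))
      =O[atTop] fun N : ℕ => 1 / (N : ℝ) := by
  have ht := tendsto_div_pow hd hu
  refine (((Real.hasDerivAt_log hc).isBigO_sub.comp_tendsto ht).trans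
    (isBigO_div_pow_sub hd hu)).congr' ?_ .rfl
  filter_upwards [eventually_gt_atTop 0, ht.eventually_ne hc] with N hN hne
  have : (N : ℝ) ^ d ≠ 0 := by positivity
  have hu0 : u N ≠ 0 := by
    rintro h
    simp [h] at hne
  simp only [Function.comp_apply]
  rw [Real.log_div hu0 this, Real.log_pow]
  ring

theorem isBigO_inv_pow_one_div (hd : 1 ≤ d) :
    (fun N : ℕ => ((N : ℝ) ^ d)⁻¹) =O[atTop] fun N : ℕ => 1 / (N : ℝ) := by
  refine IsBigO.of_bound 1 ?_
  filter_upwards [eventually_gt_atTop 0] with N hN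
  have hN' : (1 : ℝ) ≤ N := by exact_mod_cast hN
  rw [one_mul, one_div, norm_inv, norm_inv, norm_pow, Real.norm_natCast]
  exact inv_anti₀ (by positivity) (le_self_pow₀ hN' (by omega))

end LeadingTerm

theorem isBigO_div_of_leading_terms_lt {d₁ d₂ : ℕ} {c₁ c₂ : ℝ} {u v : ℕ → ℝ}
    (hd₁ : 1 ≤ d₁) (hd : d₁ < d₂) (hc₂ : c₂ ≠ 0)
    (hu : (fun N : ℕ => u N - c₁ * (N : ℝ) ^ d₁) =O[atTop] fun N : ℕ => (N : ℝ) ^ (d₁ - 1))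
    (hv : (fun N : ℕ => v N - c₂ * (N : ℝ) ^ d₂) =O[atTop] fun N : ℕ => (N : ℝ) ^ (d₂ - 1)) :
    (fun N : ℕ => u N / v N) =O[atTop] fun N : ℕ => 1 / (N : ℝ) := by
  have h₁ := (tendsto_div_pow hd₁ hu).isBigO_one ℝ
  have h₂ := isBigO_inv_of_leading_term (hd₁.trans hd.le) hc₂ hv
  refine IsBigO.trans ((h₁.mul (h₂.mul (isBigO_refl (fun N : ℕ => (N : ℝ) ^ d₁) atTop))).congr'
    ?_ ?_) (isBigO_inv_pow_one_div (d := d₂ - d₁) (by omega))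
  · filter_upwards [eventually_gt_atTop 0] with N hN
    have : (N : ℝ) ≠ 0 := by exact_mod_cast hN.ne'
    field_simp
  · filter_upwards [eventually_gt_atTop 0] with N hN
    have : (N : ℝ) ≠ 0 := by exact_mod_cast hN.ne'
    obtain ⟨e, rfl⟩ := Nat.exists_eq_add_of_le hd.le
    simp only [Nat.add_sub_cancel_left, pow_add]
    field_simp

theorem isBigO_div_sub_of_leading_terms {d : ℕ} {c₁ c₂ : ℝ} {u v : ℕ → ℝ}
    (hd : 1 ≤ d) (hc₂ : c₂ ≠ 0)
    (hu : (fun N : ℕ => u N - c₁ * (N : ℝ) ^ d) =O[atTop] fun N : ℕ => (N : ℝ) ^ (d - 1))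
    (hv : (fun N : ℕ => v N - c₂ * (N : ℝ) ^ d) =O[atTop] fun N : ℕ => (N : ℝ) ^ (d - 1)) :
    (fun N : ℕ => u N / v N - c₁ / c₂) =O[atTop] fun N : ℕ => 1 / (N : ℝ) := by
  have ht := tendsto_div_pow hd hv
  have h := (((isBigO_div_pow_sub hd hu).sub
    ((isBigO_div_pow_sub hd hv).const_mul_left (c₁ / c₂))).mul ((ht.inv₀ hc₂).isBigO_one ℝ))
  refine h.congr' ?_ (by simp)
  filter_upwards [eventually_gt_atTop 0, ht.eventually_ne hc₂] with N hN hne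
  have hN' : (N : ℝ) ≠ 0 := by exact_mod_cast hN.ne'
  have hv0 : v N ≠ 0 := by
    rintro h
    simp [h] at hne
  field_simp
  ring

/-- Let `d₁ ≤ d₂` be positive integers, `c₁, c₂ > 0`, and let
`m, n : ℕ → ℕ` be sequences of positive integers with
`m N = c₁ N^{d₁} + O(N^{d₁−1})` and `n N = c₂ N^{d₂} + O(N^{d₂−1})`.  Then
`H_{m N · n N} − H_{n N} − (m N − 1)/(2 n N)` equals
`d₁ ln N + ln c₁ − c₁/(2c₂) + O(1/N)` if `d₁ = d₂`, and
`d₁ ln N + ln c₁ + O(1/N)` if `d₁ < d₂`. -/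
theorem harmonic_average_entropy_asymptotics
    (d₁ d₂ : ℕ) (hd₁ : 1 ≤ d₁) (hd : d₁ ≤ d₂)
    (c₁ c₂ : ℝ) (hc₁ : 0 < c₁) (hc₂ : 0 < c₂)
    (m n : ℕ → ℕ) (hmpos : ∀ N, 0 < m N) (hnpos : ∀ N, 0 < n N)
    (hm : (fun N : ℕ => (m N : ℝ) - c₁ * (N : ℝ) ^ d₁)
        =O[atTop] fun N : ℕ => (N : ℝ) ^ (d₁ - 1))
    (hn : (fun N : ℕ => (n N : ℝ) - c₂ * (N : ℝ) ^ d₂)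
        =O[atTop] fun N : ℕ => (N : ℝ) ^ (d₂ - 1)) :
    (d₁ = d₂ →
      (fun N : ℕ =>
          (harmonicR (m N * n N) - harmonicR (n N) - ((m N : ℝ) - 1) / (2 * (n N : ℝ))) -
            (d₁ * Real.log N + Real.log c₁ - c₁ / (2 * c₂)))
        =O[atTop] fun N : ℕ => 1 / (N : ℝ)) ∧
    (d₁ < d₂ →
      (fun N : ℕ =>
          (harmonicR (m N * n N) - harmonicR (n N) - ((m N : ℝ) - 1) / (2 * (n N : ℝ))) -
            (d₁ * Real.log N + Real.log c₁))
        =O[atTop] fun N : ℕ => 1 / (N : ℝ)) := by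
  have hd₂ : 1 ≤ d₂ := hd₁.trans hd
  have hinv : (fun N : ℕ => ((n N : ℝ))⁻¹) =O[atTop] fun N : ℕ => 1 / (N : ℝ) :=
    (isBigO_inv_of_leading_term hd₂ hc₂.ne' hn).trans (isBigO_inv_pow_one_div hd₂)
  have hH : (fun N : ℕ => harmonicR (m N * n N) - harmonicR (n N) - Real.log (m N))
      =O[atTop] fun N : ℕ => 1 / (N : ℝ) := by
    refine IsBigO.trans (IsBigO.of_bound 2 (Eventually.of_forall fun N => ?_)) hinv
    rw [norm_inv, Real.norm_natCast, ← one_div]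
    exact abs_harmonicR_mul_sub_harmonicR_sub_log_le (hmpos N) (hnpos N)
  have hmain := (hH.add (isBigO_log_sub hd₁ hc₁.ne' hm)).add (hinv.const_mul_left (1 / 2))
  constructor
  · rintro rfl
    refine (hmain.sub ((isBigO_div_sub_of_leading_terms hd₁ hc₂.ne' hm hn).const_mul_left
      (1 / 2))).congr_left fun N => ?_
    have : (n N : ℝ) ≠ 0 := by exact_mod_cast (hnpos N).ne'
    field_simp
    ring
  · intro hlt
    refine (hmain.sub ((isBigO_div_of_leading_terms_lt hd₁ hlt hc₂.ne' hm hn).const_mul_left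
      (1 / 2))).congr_left fun N => ?_
    have : (n N : ℝ) ≠ 0 := by exact_mod_cast (hnpos N).ne'
    field_simp
    ring
end
end

section
/- Let m ≥ 1 be an integer, α ≥ 0 a real number, and g : ℝ^m → ℝ a bounded continuous function. Let T_m = {x ∈ ℝ^m : x_j ≥ 0, Σ x_j ≤ 1} and F_m = {x ∈ ℝ^m : x_j ≥ 0, Σ x_j = 1}. Then [∫_{T_m} g(p/Σ_k p_k) Π_{j<k}(p_k−p_j)² Π_j p_j^{α} dp] / [∫_{T_m} Π_{j<k}(p_k−p_j)² Π_j p_j^{α} dp] = [∫_{F_m} g(q) Π_{j<k}(q_k−q_j)² Π_j q_j^{α} dq_1…dq_{m−1}] / [∫_{F_m} Π_{j<k}(q_k−q_j)² Π_j q_j^{α} dq_1…dq_{m−1}], where p/Σ_k p_k denotes (p_1/Σp_k,…,p_m/Σp_k), and F_m is parametrized by (q_1,…,q_{m−1}) with q_m = 1 − Σ_{j<m} q_j. -/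
open MeasureTheory

noncomputable section

/-- The corner simplex `T_m = {x ∈ ℝ^m : x_j ≥ 0, ∑ x_j ≤ 1}`. -/
def cornerSimplex (m : ℕ) : Set (Fin m → ℝ) :=
  {p | (∀ j, 0 ≤ p j) ∧ ∑ j, p j ≤ 1}

/-- The parameter domain for the probability simplex `F_m`, consisting of the
first `m−1` coordinates: `q_j ≥ 0` with `q_1 + … + q_{m−1} ≤ 1`
(so that `q_m = 1 − ∑_{j<m} q_j ≥ 0`). -/
def simplexDom (m : ℕ) : Set (Fin (m - 1) → ℝ) :=
  {q | (∀ j, 0 ≤ q j) ∧ ∑ j, q j ≤ 1}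

/-- The point of the probability simplex `F_m ⊆ ℝ^m` parametrized by its first
`m−1` coordinates, with the last coordinate `q_m = 1 − ∑_{j<m} q_j`. -/
def simplexExt (m : ℕ) (q : Fin (m - 1) → ℝ) : Fin m → ℝ :=
  fun i => if h : (i : ℕ) < m - 1 then q ⟨i, h⟩ else 1 - ∑ j, q j

theorem simplexExt_succ_eq_insertNth (n : ℕ) (q : Fin n → ℝ) :
    simplexExt (n + 1) q = (Fin.last n).insertNth (α := fun _ => ℝ) (1 - ∑ j, q j) q := by
  funext i
  refine Fin.lastCases ?_ (fun j => ?_) i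
  · simp [simplexExt]
  · simp [simplexExt]

theorem sum_insertNth_last (n : ℕ) (a : ℝ) (y : Fin n → ℝ) :
    ∑ j, (Fin.last n).insertNth (α := fun _ => ℝ) a y j = (∑ j, y j) + a := by
  simp [Fin.sum_univ_castSucc]

theorem sum_simplexExt_succ (n : ℕ) (q : Fin n → ℝ) : ∑ j, simplexExt (n + 1) q j = 1 := by
  rw [simplexExt_succ_eq_insertNth, sum_insertNth_last]
  ring

theorem simplexExt_succ_nonneg_iff (n : ℕ) (q : Fin n → ℝ) :
    (∀ j, 0 ≤ simplexExt (n + 1) q j) ↔ q ∈ simplexDom (n + 1) := by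
  rw [simplexExt_succ_eq_insertNth, Fin.forall_fin_succ']
  simp [simplexDom]

/-- Coordinates on `ℝ^(n+1)` given by the sum of the entries and the first `n` entries. -/
def ofSumInit (n : ℕ) (z : ℝ × (Fin n → ℝ)) : Fin (n + 1) → ℝ :=
  (Fin.last n).insertNth (α := fun _ => ℝ) (z.1 - ∑ j, z.2 j) z.2

theorem sum_ofSumInit (n : ℕ) (z : ℝ × (Fin n → ℝ)) : ∑ j, ofSumInit n z j = z.1 := by
  rw [ofSumInit, sum_insertNth_last]
  ring

theorem ofSumInit_smul (n : ℕ) (s : ℝ) (q : Fin n → ℝ) :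
    ofSumInit n (s, s • q) = s • simplexExt (n + 1) q := by
  rw [simplexExt_succ_eq_insertNth]
  funext i
  refine Fin.lastCases ?_ (fun j => ?_) i
  · simp [ofSumInit, mul_sub, Finset.mul_sum]
  · simp [ofSumInit]

theorem measurePreserving_ofSumInit (n : ℕ) : MeasurePreserving (ofSumInit n) := by
  have hshear : MeasurePreserving
      (fun z : (Fin n → ℝ) × ℝ => (z.1, z.2 - ∑ j, z.1 j)) (volume.prod volume)
      (volume.prod volume) := by
    refine (MeasurePreserving.id volume).skew_product
      (g := fun (y : Fin n → ℝ) (s : ℝ) => s - ∑ j, y j) (by fun_prop) ?_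
    exact Filter.Eventually.of_forall fun y =>
      (measurePreserving_sub_right volume (∑ j, y j)).map_eq
  exact ((volume_preserving_piFinSuccAbove (fun _ => ℝ) (Fin.last n)).symm _).comp
    (Measure.measurePreserving_swap.comp (hshear.comp Measure.measurePreserving_swap))

theorem measurableSet_cornerSimplex (m : ℕ) : MeasurableSet (cornerSimplex m) := by
  have : cornerSimplex m = (⋂ j, {p | 0 ≤ p j}) ∩ {p | ∑ j, p j ≤ 1} := by
    ext p
    simp [cornerSimplex]
  rw [this]
  exact (MeasurableSet.iInter fun j => measurableSet_le (by fun_prop) (by fun_prop)).inter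
    (measurableSet_le (by fun_prop) (by fun_prop))

theorem measurableSet_simplexDom (m : ℕ) : MeasurableSet (simplexDom m) :=
  measurableSet_cornerSimplex (m - 1)

theorem cornerSimplex_le_one {m : ℕ} {p : Fin m → ℝ} (hp : p ∈ cornerSimplex m) (j : Fin m) :
    p j ≤ 1 :=
  (Finset.single_le_sum (fun i _ => hp.1 i) (Finset.mem_univ j)).trans hp.2

theorem volume_cornerSimplex_lt_top (m : ℕ) : volume (cornerSimplex m) < ⊤ :=
  (measure_mono fun _ hp => Set.mem_Icc.2 ⟨hp.1, cornerSimplex_le_one hp⟩).trans_lt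
    (isCompact_Icc (a := (0 : Fin m → ℝ)) (b := 1)).measure_lt_top

/-- Polar decomposition over the corner simplex of a function that is homogeneous along rays
through the probability simplex. -/
theorem setIntegral_cornerSimplex_of_homogeneous (n : ℕ) (F : (Fin (n + 1) → ℝ) → ℝ) (c : ℝ → ℝ)
    (hF : IntegrableOn F (cornerSimplex (n + 1)))
    (hc : ∀ s, 0 < s → ∀ x : Fin (n + 1) → ℝ, (∀ j, 0 ≤ x j) → ∑ j, x j = 1 →
      F (s • x) = c s * F x) :
    ∫ p in cornerSimplex (n + 1), F p =
      (∫ s in (0 : ℝ)..1, s ^ n * c s) *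
        ∫ q in simplexDom (n + 1), F (simplexExt (n + 1) q) := by
  set f := (cornerSimplex (n + 1)).indicator F with hf
  set I := ∫ q in simplexDom (n + 1), F (simplexExt (n + 1) q) with hI
  have hfi : Integrable f := (integrable_indicator_iff (measurableSet_cornerSimplex _)).2 hF
  have hmp := measurePreserving_ofSumInit n
  have hfibre : ∀ s : ℝ, s ≠ 0 → ∫ y, f (ofSumInit n (s, y)) =
      (Set.Ioc (0 : ℝ) 1).indicator (fun s => s ^ n * c s * I) s := by
    intro s hs
    by_cases hmem : s ∈ Set.Ioc (0 : ℝ) 1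
    · rw [Set.indicator_of_mem hmem]
      have hpos := hmem.1
      have hscale := Measure.integral_comp_smul (volume : Measure (Fin n → ℝ))
        (fun y => f (ofSumInit n (s, y))) s
      rw [Module.finrank_fin_fun, abs_of_pos (by positivity), smul_eq_mul] at hscale
      have hpoint : ∀ q : Fin n → ℝ, f (ofSumInit n (s, s • q)) =
          (simplexDom (n + 1)).indicator (fun q => c s * F (simplexExt (n + 1) q)) q := by
        intro q
        rw [ofSumInit_smul]
        have hiff : s • simplexExt (n + 1) q ∈ cornerSimplex (n + 1) ↔
            q ∈ simplexDom (n + 1) := by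
          rw [← simplexExt_succ_nonneg_iff]
          simp [cornerSimplex, hpos, ← Finset.mul_sum, sum_simplexExt_succ, hmem.2]
        by_cases hq : q ∈ simplexDom (n + 1)
        · rw [Set.indicator_of_mem hq, hf, Set.indicator_of_mem (hiff.2 hq)]
          exact hc s hpos _ ((simplexExt_succ_nonneg_iff n q).2 hq) (sum_simplexExt_succ n q)
        · rw [Set.indicator_of_notMem hq, hf, Set.indicator_of_notMem (mt hiff.1 hq)]
      have hslice : ∫ q, f (ofSumInit n (s, s • q)) = c s * I := by
        simp_rw [hpoint]
        exact (integral_indicator (measurableSet_simplexDom (n + 1))).trans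
          (integral_const_mul _ _)
      rw [hslice] at hscale
      rw [mul_assoc, hscale]
      field_simp
    · rw [Set.indicator_of_notMem hmem]
      refine integral_eq_zero_of_ae (Filter.Eventually.of_forall fun y => ?_)
      refine Set.indicator_of_notMem (fun hy => hmem ?_) F
      have hsum : ∑ j, ofSumInit n (s, y) j = s := sum_ofSumInit n (s, y)
      exact ⟨lt_of_le_of_ne ((Finset.sum_nonneg fun j _ => hy.1 j).trans hsum.le) hs.symm,
        hsum.symm.le.trans hy.2⟩
  have hae : ∀ᵐ s : ℝ, ∫ y, f (ofSumInit n (s, y)) =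
      (Set.Ioc (0 : ℝ) 1).indicator (fun s => s ^ n * c s * I) s := by
    filter_upwards [Measure.ae_ne volume (0 : ℝ)] with s hs using hfibre s hs
  calc ∫ p in cornerSimplex (n + 1), F p
      = ∫ p, f p := (integral_indicator (measurableSet_cornerSimplex _)).symm
    _ = ∫ z, f (ofSumInit n z) := by
        rw [← hmp.map_eq]
        exact integral_map hmp.measurable.aemeasurable (hmp.map_eq.symm ▸ hfi.1)
    _ = ∫ s, ∫ y, f (ofSumInit n (s, y)) :=
        integral_prod _ (hmp.integrable_comp_of_integrable hfi)
    _ = (∫ s in (0 : ℝ)..1, s ^ n * c s) * I := by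
        rw [integral_congr_ae hae, integral_indicator measurableSet_Ioc, integral_mul_const,
          intervalIntegral.integral_of_le zero_le_one]

theorem integrableOn_cornerSimplex_weight (m : ℕ) (α : ℝ) (hα : 0 ≤ α) (g : (Fin m → ℝ) → ℝ)
    (hg : Measurable g) (C : ℝ) (hC : ∀ x, |g x| ≤ C) :
    IntegrableOn (fun p => g (fun j => p j / ∑ k, p k) *
      ((∏ j, ∏ k ∈ Finset.Ioi j, (p k - p j) ^ 2) * ∏ j, p j ^ α)) (cornerSimplex m) := by
  refine Measure.integrableOn_of_bounded (M := C) (volume_cornerSimplex_lt_top m).ne ?_ ?_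
  · exact ((hg.comp (by fun_prop)).mul (by fun_prop)).aestronglyMeasurable
  · refine (ae_restrict_iff' (measurableSet_cornerSimplex m)).2
      (Filter.Eventually.of_forall fun p hp => ?_)
    have hvand : |∏ j, ∏ k ∈ Finset.Ioi j, (p k - p j) ^ 2| ≤ 1 := by
      simp_rw [Finset.abs_prod]
      refine Finset.prod_le_one (fun _ _ => by positivity) fun j _ =>
        Finset.prod_le_one (fun _ _ => by positivity) fun k _ => ?_
      rw [abs_pow, sq_abs, sq_le_one_iff_abs_le_one, abs_le]
      constructor <;> linarith [hp.1 j, hp.1 k, cornerSimplex_le_one hp j,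
        cornerSimplex_le_one hp k]
    have hpow : |∏ j, p j ^ α| ≤ 1 := by
      rw [Finset.abs_prod]
      refine Finset.prod_le_one (fun _ _ => by positivity) fun j _ => ?_
      rw [abs_of_nonneg (Real.rpow_nonneg (hp.1 j) α)]
      exact Real.rpow_le_one (hp.1 j) (cornerSimplex_le_one hp j) hα
    rw [Real.norm_eq_abs, abs_mul, abs_mul]
    exact (mul_le_of_le_one_right (abs_nonneg _)
      (mul_le_one₀ hvand (abs_nonneg _) hpow)).trans (hC _)

theorem setIntegral_cornerSimplex_weight (n : ℕ) (α : ℝ) (hα : 0 ≤ α)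
    (g : (Fin (n + 1) → ℝ) → ℝ) (hg : Measurable g) (C : ℝ) (hC : ∀ x, |g x| ≤ C) :
    ∫ p in cornerSimplex (n + 1), g (fun j => p j / ∑ k, p k) *
        ((∏ j, ∏ k ∈ Finset.Ioi j, (p k - p j) ^ 2) * ∏ j, p j ^ α) =
      (∫ s in (0 : ℝ)..1, s ^ n *
        ((∏ j : Fin (n + 1), ∏ _k ∈ Finset.Ioi j, s ^ 2) * ∏ _j : Fin (n + 1), s ^ α)) *
      ∫ q in simplexDom (n + 1), g (simplexExt (n + 1) q) *
        ((∏ j, ∏ k ∈ Finset.Ioi j,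
          (simplexExt (n + 1) q k - simplexExt (n + 1) q j) ^ 2) *
            ∏ j, simplexExt (n + 1) q j ^ α) := by
  rw [setIntegral_cornerSimplex_of_homogeneous n _
    (fun s => (∏ j : Fin (n + 1), ∏ _k ∈ Finset.Ioi j, s ^ 2) * ∏ _j : Fin (n + 1), s ^ α)
    (integrableOn_cornerSimplex_weight (n + 1) α hα g hg C hC)]
  · simp only [sum_simplexExt_succ, div_one]
  · intro s hs x hx hsum
    have hnormalize : (fun j => (s • x) j / ∑ k, (s • x) k) = fun j => x j / ∑ k, x k := by
      funext j
      simp only [Pi.smul_apply, smul_eq_mul, ← Finset.mul_sum, hsum]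
      field_simp
    have hpow : ∀ j, (s • x) j ^ α = s ^ α * x j ^ α := fun j =>
      Real.mul_rpow hs.le (hx j)
    have hdiff : ∀ j k, ((s • x) k - (s • x) j) ^ 2 = s ^ 2 * (x k - x j) ^ 2 := fun j k => by
      simp only [Pi.smul_apply, smul_eq_mul]
      ring
    simp only [hnormalize, hpow, hdiff, Finset.prod_mul_distrib]
    ring

theorem radial_integral_pos (n : ℕ) (α : ℝ) (hα : 0 ≤ α) :
    0 < ∫ s in (0 : ℝ)..1, s ^ n *
      ((∏ j : Fin (n + 1), ∏ _k ∈ Finset.Ioi j, s ^ 2) * ∏ _j : Fin (n + 1), s ^ α) := by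
  refine intervalIntegral.intervalIntegral_pos_of_pos_on (Continuous.intervalIntegrable ?_ _ _)
    (fun s hs => ?_) zero_lt_one
  · have := Real.continuous_rpow_const hα
    fun_prop
  · have := hs.1
    positivity

/-- For `m ≥ 1`, `α ≥ 0` and a bounded continuous
`g : ℝ^m → ℝ`, the normalized integral of `g(p/∑ p_k)` over the corner simplex
`T_m` against the density `∏_{j<k}(p_k−p_j)² ∏_j p_j^α` equals the normalized
integral of `g` over the probability simplex `F_m` (parametrized by its first
`m−1` coordinates) against the same density. -/
theorem corner_to_simplex_ratio (m : ℕ) (hm : 1 ≤ m) (α : ℝ) (hα : 0 ≤ α)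
    (g : (Fin m → ℝ) → ℝ) (hg : Continuous g) (hgb : ∃ C : ℝ, ∀ x, |g x| ≤ C) :
    (∫ p in cornerSimplex m,
        g (fun j => p j / ∑ k, p k) *
          ((∏ j, ∏ k ∈ Finset.Ioi j, (p k - p j) ^ 2) * ∏ j, p j ^ α)) /
    (∫ p in cornerSimplex m,
        (∏ j, ∏ k ∈ Finset.Ioi j, (p k - p j) ^ 2) * ∏ j, p j ^ α) =
    (∫ q in simplexDom m,
        g (simplexExt m q) *
          ((∏ j, ∏ k ∈ Finset.Ioi j, (simplexExt m q k - simplexExt m q j) ^ 2) *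
            ∏ j, simplexExt m q j ^ α)) /
    (∫ q in simplexDom m,
        (∏ j, ∏ k ∈ Finset.Ioi j, (simplexExt m q k - simplexExt m q j) ^ 2) *
          ∏ j, simplexExt m q j ^ α) := by
  obtain ⟨n, rfl⟩ := Nat.exists_eq_succ_of_ne_zero (Nat.one_le_iff_ne_zero.1 hm)
  obtain ⟨C, hC⟩ := hgb
  have hnum := setIntegral_cornerSimplex_weight n α hα g hg.measurable C hC
  have hden := setIntegral_cornerSimplex_weight n α hα (fun _ => 1) measurable_const 1 (by simp)
  simp only [one_mul] at hden
  exact (congrArg₂ (· / ·) hnum hden).trans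
    (mul_div_mul_left _ _ (radial_integral_pos n α hα).ne')
end
end
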